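/- arXiv:2301.09086 — 2 statements merged into one kernel-verified Lean document; each statement's English description precedes it below -/
import Mathlib

section
/- Let u be a classical solution of the wave equation on 0 < x < ℓ(t) with u(0,t) = 0 and the undamped boundary condition u_x(ℓ(t),t) + ℓ′(t) u_t(ℓ(t),t) = 0. If −1 < ℓ′(t) ≤ 0 for all t in an interval [t₁,t₂], then the energy E(t) is nondecreasing on [t₁,t₂]; if 0 ≤ ℓ′(t) < 1 for all t in [t₁,t₂], then E(t) is nonincreasing on [t₁,t₂]. -/
open Set Filter Topology MeasureTheory

/-- The space-time region `0 ≤ x ≤ ℓ t`, `0 ≤ t`. -/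
def movingRegion (ℓ : ℝ → ℝ) : Set (ℝ × ℝ) := {p | 0 ≤ p.2 ∧ p.1 ∈ Icc 0 (ℓ p.2)}

/-- Continuity of a parametric integral over `[0, 1]` on the half-line. -/
lemma continuousOn_integral_of_continuousOn_prod {g : ℝ × ℝ → ℝ}
    (hg : ContinuousOn g (Ici 0 ×ˢ Icc 0 1)) :
    ContinuousOn (fun t => ∫ s in (0:ℝ)..1, g (t, s)) (Ici 0) := by
  have hc : Continuous (fun p : ℝ × ℝ => g (max p.1 0, max 0 (min p.2 1))) := by
    refine hg.comp_continuous (by fun_prop) fun p => ?_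
    exact ⟨mem_Ici.2 (le_max_right _ _), le_max_left _ _, max_le zero_le_one (min_le_right _ _)⟩
  have hI : Continuous (fun t => ∫ s in (0:ℝ)..1, g (max t 0, max 0 (min s 1))) :=
    intervalIntegral.continuous_parametric_intervalIntegral_of_continuous' hc 0 1
  refine hI.continuousOn.congr fun t ht => ?_
  refine intervalIntegral.integral_congr fun s hs => ?_
  rw [uIcc_of_le zero_le_one] at hs
  simp only [max_eq_left (mem_Ici.1 ht), min_eq_left hs.2, max_eq_right hs.1]

/-- Differentiation under the integral sign over `[0, 1]` for positive parameters. -/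
lemma hasDerivAt_integral_of_continuousOn_prod {g g' : ℝ × ℝ → ℝ}
    (hg : ContinuousOn g (Ici 0 ×ˢ Icc 0 1)) (hg' : ContinuousOn g' (Ici 0 ×ˢ Icc 0 1))
    (hd : ∀ t, 0 < t → ∀ s ∈ Icc (0:ℝ) 1, HasDerivAt (fun τ => g (τ, s)) (g' (t, s)) t)
    {t : ℝ} (ht : 0 < t) :
    HasDerivAt (fun τ => ∫ s in (0:ℝ)..1, g (τ, s)) (∫ s in (0:ℝ)..1, g' (t, s)) t := by
  have hslice : ∀ {h : ℝ × ℝ → ℝ}, ContinuousOn h (Ici 0 ×ˢ Icc 0 1) → ∀ τ, 0 ≤ τ →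
      IntervalIntegrable (fun s => h (τ, s)) volume 0 1 := by
    intro h hh τ hτ
    apply ContinuousOn.intervalIntegrable
    rw [uIcc_of_le zero_le_one]
    exact hh.comp (by fun_prop) fun s hs => ⟨hτ, hs⟩
  have hsub : Icc 0 (t + 1) ×ˢ Icc (0:ℝ) 1 ⊆ Ici 0 ×ˢ Icc 0 1 :=
    prod_mono Icc_subset_Ici_self subset_rfl
  obtain ⟨C, hC⟩ :=
    (isCompact_Icc.prod isCompact_Icc).exists_bound_of_continuousOn (hg'.mono hsub)
  have hmem : Ioo 0 (t + 1) ∈ 𝓝 t := Ioo_mem_nhds ht (by linarith)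
  have hIoc : ∀ {s : ℝ}, s ∈ uIoc (0:ℝ) 1 → s ∈ Icc (0:ℝ) 1 := fun {s} hs => by
    rw [uIoc_of_le zero_le_one] at hs
    exact Ioc_subset_Icc_self hs
  refine (intervalIntegral.hasDerivAt_integral_of_dominated_loc_of_deriv_le
    (F := fun τ s => g (τ, s)) (F' := fun τ s => g' (τ, s)) (bound := fun _ => C)
    hmem ?_ (hslice hg t ht.le) (hslice hg' t ht.le).def'.aestronglyMeasurable ?_
    intervalIntegrable_const ?_).2
  · filter_upwards [hmem] with τ hτ
    exact (hslice hg τ hτ.1.le).def'.aestronglyMeasurable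
  · exact Eventually.of_forall fun s hs τ hτ => hC (τ, s) ⟨Ioo_subset_Icc_self hτ, hIoc hs⟩
  · exact Eventually.of_forall fun s hs τ hτ => hd τ hτ.1 s (hIoc hs)

/-- An integral over `[0, ℓ]` rescaled to `[0, 1]`. -/
lemma integral_eq_rescaled (ℓ : ℝ) (e : ℝ → ℝ) :
    ∫ x in (0:ℝ)..ℓ, e x = ∫ s in (0:ℝ)..1, ℓ * e (ℓ * s) := by
  rw [intervalIntegral.integral_const_mul, intervalIntegral.mul_integral_comp_mul_left]
  simp

lemma mul_mem_movingRegion {ℓ : ℝ → ℝ} (hℓpos : ∀ t ∈ Ici (0:ℝ), 0 < ℓ t) {q : ℝ × ℝ}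
    (hq : q ∈ Ici (0:ℝ) ×ˢ Icc (0:ℝ) 1) : (ℓ q.1 * q.2, q.1) ∈ movingRegion ℓ :=
  ⟨hq.1, mul_nonneg (hℓpos _ hq.1).le hq.2.1,
    mul_le_of_le_one_right (hℓpos _ hq.1).le hq.2.2⟩

lemma continuousOn_rescaled {ℓ : ℝ → ℝ} (hℓc : ContinuousOn ℓ (Ici 0))
    {U : Set (ℝ × ℝ)} (hℓpos : ∀ t ∈ Ici (0:ℝ), 0 < ℓ t) (hUK : movingRegion ℓ ⊆ U)
    {F : Type*} [TopologicalSpace F] {h : ℝ × ℝ → F} (hh : ContinuousOn h U) :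
    ContinuousOn (fun q : ℝ × ℝ => h (ℓ q.1 * q.2, q.1)) (Ici 0 ×ˢ Icc 0 1) := by
  have hℓ1 : ContinuousOn (fun q : ℝ × ℝ => ℓ q.1) (Ici 0 ×ˢ Icc 0 1) :=
    hℓc.comp continuousOn_fst fun q hq => hq.1
  exact hh.comp ((hℓ1.mul continuousOn_snd).prodMk continuousOn_fst)
    fun q hq => hUK (mul_mem_movingRegion hℓpos hq)

lemma continuousOn_integral_moving {ℓ : ℝ → ℝ} (hℓc : ContinuousOn ℓ (Ici 0))
    (hℓpos : ∀ t ∈ Ici (0:ℝ), 0 < ℓ t) {U : Set (ℝ × ℝ)} (hUK : movingRegion ℓ ⊆ U)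
    {e : ℝ × ℝ → ℝ} (he : ContinuousOn e U) :
    ContinuousOn (fun t => ∫ x in (0:ℝ)..ℓ t, e (x, t)) (Ici 0) := by
  simp_rw [fun t => integral_eq_rescaled (ℓ t) (fun x => e (x, t))]
  exact continuousOn_integral_of_continuousOn_prod
    (g := fun q => ℓ q.1 * e (ℓ q.1 * q.2, q.1))
    ((hℓc.comp continuousOn_fst fun q hq => hq.1).mul (continuousOn_rescaled hℓc hℓpos hUK he))

/-- The conservation law `e_t = F_x` integrated over a moving interval. -/
lemma hasDerivAt_integral_moving {ℓ ℓ' : ℝ → ℝ} (hℓc' : ContinuousOn ℓ' (Ici 0))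
    (hℓd : ∀ t ∈ Ici (0:ℝ), HasDerivWithinAt ℓ (ℓ' t) (Ici 0) t)
    (hℓpos : ∀ t ∈ Ici (0:ℝ), 0 < ℓ t) {U : Set (ℝ × ℝ)} (hUopen : IsOpen U)
    (hUK : movingRegion ℓ ⊆ U) {e F : ℝ × ℝ → ℝ}
    (he : ContDiffOn ℝ 1 e U) (hF : ContDiffOn ℝ 1 F U)
    (hcons : ∀ p ∈ movingRegion ℓ, fderiv ℝ e p (0, 1) = fderiv ℝ F p (1, 0))
    {t : ℝ} (ht : 0 < t) :
    HasDerivAt (fun τ => ∫ x in (0:ℝ)..ℓ τ, e (x, τ))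
      (ℓ' t * e (ℓ t, t) + F (ℓ t, t) - F (0, t)) t := by
  have hℓc : ContinuousOn ℓ (Ici 0) := fun t ht => (hℓd t ht).continuousWithinAt
  have hde : ∀ p ∈ U, HasFDerivAt e (fderiv ℝ e p) p := fun p hp =>
    ((he.differentiableOn one_ne_zero).differentiableAt (hUopen.mem_nhds hp)).hasFDerivAt
  have hdF : ∀ p ∈ U, HasFDerivAt F (fderiv ℝ F p) p := fun p hp =>
    ((hF.differentiableOn one_ne_zero).differentiableAt (hUopen.mem_nhds hp)).hasFDerivAt
  have hce' := he.continuousOn_fderiv_of_isOpen hUopen le_rfl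
  have hℓ1 : ContinuousOn (fun q : ℝ × ℝ => ℓ q.1) (Ici 0 ×ˢ Icc 0 1) :=
    hℓc.comp continuousOn_fst fun q hq => hq.1
  have hℓ1' : ContinuousOn (fun q : ℝ × ℝ => ℓ' q.1) (Ici 0 ×ˢ Icc 0 1) :=
    hℓc'.comp continuousOn_fst fun q hq => hq.1
  have hce1 := continuousOn_rescaled hℓc hℓpos hUK he.continuousOn
  have hce1' := continuousOn_rescaled hℓc hℓpos hUK hce'
  have hcg' : ContinuousOn (fun q : ℝ × ℝ => ℓ' q.1 * e (ℓ q.1 * q.2, q.1) +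
      ℓ q.1 * fderiv ℝ e (ℓ q.1 * q.2, q.1) (ℓ' q.1 * q.2, 1)) (Ici 0 ×ˢ Icc 0 1) :=
    (hℓ1'.mul hce1).add
      (hℓ1.mul (hce1'.clm_apply ((hℓ1'.mul continuousOn_snd).prodMk continuousOn_const)))
  have key := hasDerivAt_integral_of_continuousOn_prod
    (g := fun q => ℓ q.1 * e (ℓ q.1 * q.2, q.1)) (hℓ1.mul hce1) hcg' (fun τ hτ s hs => by
      have hl : HasDerivAt ℓ (ℓ' τ) τ := (hℓd τ hτ.le).hasDerivAt (Ici_mem_nhds hτ)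
      have hp := hUK (mul_mem_movingRegion hℓpos (q := (τ, s)) ⟨hτ.le, hs⟩)
      have hpath : HasDerivAt (fun τ => (ℓ τ * s, τ)) (ℓ' τ * s, (1:ℝ)) τ :=
        (hl.mul_const s).prodMk (hasDerivAt_id τ)
      exact hl.mul (HasFDerivAt.comp_hasDerivAt (f := fun τ => (ℓ τ * s, τ)) τ
        (hde _ hp) hpath)) ht
  simp_rw [fun t => integral_eq_rescaled (ℓ t) (fun x => e (x, t))]
  convert key using 1
  have hftc := intervalIntegral.integral_eq_sub_of_hasDerivAt (a := 0) (b := 1)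
    (f := fun s => ℓ' t * s * e (ℓ t * s, t) + F (ℓ t * s, t))
    (f' := fun s => ℓ' t * e (ℓ t * s, t) + ℓ t * fderiv ℝ e (ℓ t * s, t) (ℓ' t * s, 1))
    (fun s hs => by
      rw [uIcc_of_le zero_le_one] at hs
      have hK := mul_mem_movingRegion hℓpos (q := (t, s)) ⟨ht.le, hs⟩
      have hpath : HasDerivAt (fun s => (ℓ t * s, t)) (ℓ t, (0:ℝ)) s := by
        simpa using ((hasDerivAt_id s).const_mul (ℓ t)).prodMk (hasDerivAt_const s t)
      have h1 := (((hasDerivAt_id s).const_mul (ℓ' t)).mul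
        ((hde _ (hUK hK)).comp_hasDerivAt s hpath)).add
        ((hdF _ (hUK hK)).comp_hasDerivAt s hpath)
      refine h1.congr_deriv ?_
      have hv : ((ℓ t, 0) : ℝ × ℝ) = ℓ t • (1, 0) := by simp
      have hw : ((ℓ' t * s, 1) : ℝ × ℝ) = (ℓ' t * s) • (1, 0) + (0, 1) := by simp
      rw [hv, hw, map_add, map_smul, map_smul, map_smul, hcons _ hK]
      simp only [smul_eq_mul, id, Function.comp]
      ring)
    (by
      apply ContinuousOn.intervalIntegrable
      rw [uIcc_of_le zero_le_one]
      exact hcg'.comp (f := fun s => (t, s)) (by fun_prop) fun s hs => ⟨ht.le, hs⟩)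
  rw [hftc]
  simp

lemma hasDerivAt_slice_snd {f : ℝ × ℝ → ℝ} {f' : ℝ × ℝ →L[ℝ] ℝ} {x t : ℝ}
    (h : HasFDerivAt f f' (x, t)) : HasDerivAt (fun τ => f (x, τ)) (f' (0, 1)) t :=
  HasFDerivAt.comp_hasDerivAt (f := fun τ => (x, τ)) t h
    ((hasDerivAt_const t x).prodMk (hasDerivAt_id t))

lemma hasDerivAt_slice_fst {f : ℝ × ℝ → ℝ} {f' : ℝ × ℝ →L[ℝ] ℝ} {x t : ℝ}
    (h : HasFDerivAt f f' (x, t)) : HasDerivAt (fun y => f (y, t)) (f' (1, 0)) x :=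
  HasFDerivAt.comp_hasDerivAt (f := fun y => (y, t)) x h
    ((hasDerivAt_id x).prodMk (hasDerivAt_const x t))

lemma deriv_slice_snd {u : ℝ → ℝ → ℝ} {x t : ℝ}
    (h : DifferentiableAt ℝ (fun p : ℝ × ℝ => u p.1 p.2) (x, t)) :
    deriv (u x) t = fderiv ℝ (fun p : ℝ × ℝ => u p.1 p.2) (x, t) (0, 1) :=
  (hasDerivAt_slice_snd h.hasFDerivAt).deriv

lemma deriv_slice_fst {u : ℝ → ℝ → ℝ} {x t : ℝ}
    (h : DifferentiableAt ℝ (fun p : ℝ × ℝ => u p.1 p.2) (x, t)) :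
    deriv (fun y => u y t) x = fderiv ℝ (fun p : ℝ × ℝ => u p.1 p.2) (x, t) (1, 0) :=
  (hasDerivAt_slice_fst h.hasFDerivAt).deriv

/-- The local energy identity `((u_t² + u_x²) / 2)_t = (u_t u_x)_x` at a point where the wave
equation holds. -/
lemma wave_energy_identity {u : ℝ → ℝ → ℝ} {U : Set (ℝ × ℝ)} (hUopen : IsOpen U)
    (hu : ContDiffOn ℝ 2 (fun p : ℝ × ℝ => u p.1 p.2) U) {a b : ℝ × ℝ → ℝ}
    (ha : a = fun p => fderiv ℝ (fun p : ℝ × ℝ => u p.1 p.2) p (1, 0))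
    (hb : b = fun p => fderiv ℝ (fun p : ℝ × ℝ => u p.1 p.2) p (0, 1))
    {x t : ℝ} (hp : (x, t) ∈ U)
    (hwave : deriv (deriv (u x)) t = deriv (deriv (fun y => u y t)) x) :
    fderiv ℝ (fun p => (1 / 2) * (b p ^ 2 + a p ^ 2)) (x, t) (0, 1) =
      fderiv ℝ (fun p => b p * a p) (x, t) (1, 0) := by
  set f : ℝ × ℝ → ℝ := fun p => u p.1 p.2 with hf
  have hnhds := hUopen.mem_nhds hp
  have hfd : ∀ p ∈ U, DifferentiableAt ℝ f p := fun p hp =>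
    (hu.differentiableOn two_ne_zero).differentiableAt (hUopen.mem_nhds hp)
  have hD : DifferentiableAt ℝ (fderiv ℝ f) (x, t) :=
    ((hu.fderiv_of_isOpen hUopen (m := 1) (by norm_num)).differentiableOn
      one_ne_zero).differentiableAt hnhds
  have happly : ∀ v : ℝ × ℝ, HasFDerivAt (fun p => fderiv ℝ f p v)
      ((fderiv ℝ (fderiv ℝ f) (x, t)).flip v) (x, t) := fun v => by
    simpa using hD.hasFDerivAt.clm_apply (hasFDerivAt_const v (x, t))
  have hda : HasFDerivAt a ((fderiv ℝ (fderiv ℝ f) (x, t)).flip (1, 0)) (x, t) :=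
    ha ▸ happly (1, 0)
  have hdb : HasFDerivAt b ((fderiv ℝ (fderiv ℝ f) (x, t)).flip (0, 1)) (x, t) :=
    hb ▸ happly (0, 1)
  have hsymm : fderiv ℝ (fderiv ℝ f) (x, t) (1, 0) (0, 1) =
      fderiv ℝ (fderiv ℝ f) (x, t) (0, 1) (1, 0) :=
    ((hu.contDiffAt hnhds).isSymmSndFDerivAt (by simp)) _ _
  have htt : deriv (deriv (u x)) t = fderiv ℝ (fderiv ℝ f) (x, t) (0, 1) (0, 1) := by
    have hev : deriv (u x) =ᶠ[𝓝 t] fun τ => b (x, τ) := by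
      have : ∀ᶠ τ in 𝓝 t, (x, τ) ∈ U :=
        (Continuous.continuousAt (by fun_prop)).eventually_mem hnhds
      filter_upwards [this] with τ hτ
      rw [hb, deriv_slice_snd (hfd _ hτ)]
    rw [hev.deriv_eq]
    exact (hasDerivAt_slice_snd hdb).deriv
  have hxx : deriv (deriv (fun y => u y t)) x =
      fderiv ℝ (fderiv ℝ f) (x, t) (1, 0) (1, 0) := by
    have hev : deriv (fun y => u y t) =ᶠ[𝓝 x] fun y => a (y, t) := by
      have : ∀ᶠ y in 𝓝 x, (y, t) ∈ U :=
        (Continuous.continuousAt (by fun_prop)).eventually_mem hnhds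
      filter_upwards [this] with y hy
      rw [ha, deriv_slice_fst (hfd _ hy)]
    rw [hev.deriv_eq]
    exact (hasDerivAt_slice_fst hda).deriv
  have he : HasFDerivAt (fun p => (1 / 2) * (b p ^ 2 + a p ^ 2)) _ (x, t) :=
    ((hdb.pow 2).add (hda.pow 2)).const_mul (1 / 2)
  have hF : HasFDerivAt (fun p => b p * a p) _ (x, t) := hdb.mul hda
  rw [he.fderiv, hF.fderiv]
  rw [htt, hxx] at hwave
  simp only [add_apply, smul_apply,
    ContinuousLinearMap.flip_apply, smul_eq_mul, nsmul_eq_mul, hsymm, hwave]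
  push_cast
  ring

/-- The energy is continuous up to `t = 0`, and `E' = -(ℓ' / 2) (1 - ℓ'²) u_t(ℓ, ·)²`. -/
lemma undamped_energy_continuousOn_and_hasDerivAt
    {ℓ ℓ' : ℝ → ℝ} (hℓC1 : ContDiffOn ℝ 1 ℓ (Ici 0))
    (hℓd : ∀ t ∈ Ici (0:ℝ), HasDerivWithinAt ℓ (ℓ' t) (Ici 0) t)
    (hℓpos : ∀ t ∈ Ici (0:ℝ), 0 < ℓ t)
    {u : ℝ → ℝ → ℝ} {U : Set (ℝ × ℝ)} (hUopen : IsOpen U) (hUK : movingRegion ℓ ⊆ U)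
    (huC2 : ContDiffOn ℝ 2 (fun p : ℝ × ℝ => u p.1 p.2) U)
    (hwave : ∀ x t : ℝ, 0 ≤ t → x ∈ Icc 0 (ℓ t) →
      deriv (deriv (u x)) t = deriv (deriv (fun y => u y t)) x)
    (hbc0 : ∀ t : ℝ, 0 ≤ t → u 0 t = 0)
    (hbcℓ : ∀ t : ℝ, 0 < t →
      deriv (fun y => u y t) (ℓ t) + ℓ' t * deriv (u (ℓ t)) t = 0)
    {E : ℝ → ℝ}
    (hE : ∀ t : ℝ, E t = (1/2) * ∫ x in (0:ℝ)..(ℓ t),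
      ((deriv (u x) t)^2 + (deriv (fun y => u y t) x)^2)) :
    ContinuousOn E (Ici 0) ∧ ∀ t, 0 < t →
      HasDerivAt E (-(ℓ' t / 2) * (1 - ℓ' t ^ 2) * deriv (u (ℓ t)) t ^ 2) t := by
  obtain ⟨a, ha⟩ : ∃ a : ℝ × ℝ → ℝ,
    a = fun p => fderiv ℝ (fun p : ℝ × ℝ => u p.1 p.2) p (1, 0) := ⟨_, rfl⟩
  obtain ⟨b, hb⟩ : ∃ b : ℝ × ℝ → ℝ,
    b = fun p => fderiv ℝ (fun p : ℝ × ℝ => u p.1 p.2) p (0, 1) := ⟨_, rfl⟩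
  have hD := huC2.fderiv_of_isOpen hUopen (m := 1) (by norm_num)
  have hCa : ContDiffOn ℝ 1 a U := ha ▸ hD.clm_apply contDiffOn_const
  have hCb : ContDiffOn ℝ 1 b U := hb ▸ hD.clm_apply contDiffOn_const
  have hfd : ∀ p ∈ U, DifferentiableAt ℝ (fun p : ℝ × ℝ => u p.1 p.2) p := fun p hp =>
    (huC2.differentiableOn two_ne_zero).differentiableAt (hUopen.mem_nhds hp)
  have hub : ∀ x t, (x, t) ∈ U → deriv (u x) t = b (x, t) := fun x t h => by
    rw [hb, deriv_slice_snd (hfd _ h)]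
  have hua : ∀ x t, (x, t) ∈ U → deriv (fun y => u y t) x = a (x, t) := fun x t h => by
    rw [ha, deriv_slice_fst (hfd _ h)]
  have hCe : ContDiffOn ℝ 1 (fun p => (1 / 2) * (b p ^ 2 + a p ^ 2)) U :=
    contDiffOn_const.mul ((hCb.pow 2).add (hCa.pow 2))
  have hEe : ∀ t ∈ Ici (0:ℝ),
      E t = ∫ x in (0:ℝ)..ℓ t, (1 / 2) * (b (x, t) ^ 2 + a (x, t) ^ 2) := by
    intro t ht
    rw [hE, ← intervalIntegral.integral_const_mul]
    refine intervalIntegral.integral_congr fun x hx => ?_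
    rw [uIcc_of_le (hℓpos t ht).le] at hx
    have hmem : (x, t) ∈ U := hUK ⟨ht, hx⟩
    simp only [hub x t hmem, hua x t hmem]
  refine ⟨(continuousOn_integral_moving hℓC1.continuousOn hℓpos hUK hCe.continuousOn).congr hEe,
    fun t ht => ?_⟩
  have hℓc' : ContinuousOn ℓ' (Ici 0) :=
    (hℓC1.continuousOn_derivWithin (uniqueDiffOn_Ici 0) le_rfl).congr fun t ht =>
      ((hℓd t ht).derivWithin (uniqueDiffOn_Ici 0 t ht)).symm
  have hder := (hasDerivAt_integral_moving hℓc' hℓd hℓpos hUopen hUK hCe (hCb.mul hCa)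
    (fun p hp => wave_energy_identity hUopen huC2 ha hb (hUK hp) (hwave p.1 p.2 hp.1 hp.2))
    ht).congr_of_eventuallyEq (eventually_of_mem (Ici_mem_nhds ht) hEe)
  have hl := (hℓpos t ht.le).le
  have hU0 : (0, t) ∈ U := hUK ⟨ht.le, left_mem_Icc.2 hl⟩
  have hUℓ : (ℓ t, t) ∈ U := hUK ⟨ht.le, right_mem_Icc.2 hl⟩
  have hb0 : b (0, t) = 0 := by
    rw [← hub 0 t hU0]
    have : u 0 =ᶠ[𝓝 t] fun _ => 0 := eventually_of_mem (Ici_mem_nhds ht) hbc0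
    rw [this.deriv_eq, deriv_const]
  have hbc := hbcℓ t ht
  rw [hua _ _ hUℓ, hub _ _ hUℓ] at hbc
  refine hder.congr_deriv ?_
  rw [hub _ _ hUℓ, hb0, eq_neg_of_add_eq_zero_left hbc]
  ring

theorem undamped_energy_monotonicity
    (ℓ ℓ' : ℝ → ℝ)
    (hℓC1 : ContDiffOn ℝ 1 ℓ (Set.Ici 0))
    (hℓd : ∀ t ∈ Set.Ici (0:ℝ), HasDerivWithinAt ℓ (ℓ' t) (Set.Ici 0) t)
    (hℓpos : ∀ t ∈ Set.Ici (0:ℝ), 0 < ℓ t)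
    (hℓspeed : ∀ t ∈ Set.Ici (0:ℝ), |ℓ' t| < 1)
    (u : ℝ → ℝ → ℝ) (U : Set (ℝ × ℝ)) (hUopen : IsOpen U)
    (hUK : {p : ℝ × ℝ | 0 ≤ p.2 ∧ p.1 ∈ Set.Icc 0 (ℓ p.2)} ⊆ U)
    (huC2 : ContDiffOn ℝ 2 (fun p : ℝ × ℝ => u p.1 p.2) U)
    (hwave : ∀ x t : ℝ, 0 ≤ t → x ∈ Set.Icc 0 (ℓ t) →
      deriv (deriv (u x)) t = deriv (deriv (fun y => u y t)) x)
    (hbc0 : ∀ t : ℝ, 0 ≤ t → u 0 t = 0)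
    (hbcℓ : ∀ t : ℝ, 0 < t →
      deriv (fun y => u y t) (ℓ t) + ℓ' t * deriv (u (ℓ t)) t = 0)
    (E : ℝ → ℝ)
    (hE : ∀ t : ℝ, E t = (1/2) * ∫ x in (0:ℝ)..(ℓ t),
      ((deriv (u x) t)^2 + (deriv (fun y => u y t) x)^2))
    (t₁ t₂ : ℝ) (ht₁ : 0 ≤ t₁)
    : ((∀ t ∈ Set.Icc t₁ t₂, -1 < ℓ' t ∧ ℓ' t ≤ 0) → MonotoneOn E (Set.Icc t₁ t₂)) ∧
      ((∀ t ∈ Set.Icc t₁ t₂, 0 ≤ ℓ' t ∧ ℓ' t < 1) → AntitoneOn E (Set.Icc t₁ t₂)) := by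
  obtain ⟨hcont, hder⟩ := undamped_energy_continuousOn_and_hasDerivAt hℓC1 hℓd hℓpos hUopen hUK
    huC2 hwave hbc0 hbcℓ hE
  have hc : ContinuousOn E (Icc t₁ t₂) := hcont.mono fun t ht => ht₁.trans ht.1
  have hpos : ∀ t ∈ Ioo t₁ t₂, 0 < t := fun t ht => ht₁.trans_lt ht.1
  have hfac : ∀ t ∈ Ioo t₁ t₂, 0 ≤ 1 - ℓ' t ^ 2 := fun t ht =>
    sub_nonneg.2 ((sq_le_one_iff_abs_le_one _).2 (hℓspeed t (hpos t ht).le).le)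
  constructor <;> intro h
  · refine monotoneOn_of_hasDerivWithinAt_nonneg (convex_Icc _ _) hc
      (fun t ht => (hder t (hpos t (by rwa [interior_Icc] at ht))).hasDerivWithinAt) fun t ht => ?_
    rw [interior_Icc] at ht
    have := (h t (Ioo_subset_Icc_self ht)).2
    exact mul_nonneg (mul_nonneg (by linarith) (hfac t ht)) (sq_nonneg _)
  · refine antitoneOn_of_hasDerivWithinAt_nonpos (convex_Icc _ _) hc
      (fun t ht => (hder t (hpos t (by rwa [interior_Icc] at ht))).hasDerivWithinAt) fun t ht => ?_
    rw [interior_Icc] at ht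
    have := (h t (Ioo_subset_Icc_self ht)).1
    exact mul_nonpos_of_nonpos_of_nonneg
      (mul_nonpos_of_nonpos_of_nonneg (by linarith) (hfac t ht)) (sq_nonneg _)
end

section
/- In the undamped case (boundary condition u_x(ℓ(t),t) + ℓ′(t) u_t(ℓ(t),t) = 0), suppose φ′ is monotone on [t₀ − ℓ(t₀), t₁ + ℓ(t₁)] and 0 ≤ ℓ′(t) < 1 for all t ∈ [t₀,t₁]. Then φ′ is nonincreasing there, the energy E(t) is nonincreasing on [t₀,t₁], and for all t ∈ [t₀,t₁]: (φ′(t + ℓ(t))/φ′(t₀ − ℓ(t₀))) E(t₀) ≤ E(t) ≤ (φ′(t − ℓ(t))/φ′(t₀ + ℓ(t₀))) E(t₀). -/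
/-- The spatial and temporal partial derivatives of `u`, in terms of its total derivative. -/
lemma deriv_partials_eq_fderiv {u : ℝ → ℝ → ℝ} {x t : ℝ}
    (h : DifferentiableAt ℝ (fun p : ℝ × ℝ => u p.1 p.2) (x, t)) :
    deriv (u x) t = fderiv ℝ (fun p : ℝ × ℝ => u p.1 p.2) (x, t) (0, 1) ∧
      deriv (fun y => u y t) x = fderiv ℝ (fun p : ℝ × ℝ => u p.1 p.2) (x, t) (1, 0) := by
  constructor
  · exact (h.hasFDerivAt.comp_hasDerivAt t
      ((hasDerivAt_const t x).prodMk (hasDerivAt_id t))).deriv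
  · exact (h.hasFDerivAt.comp_hasDerivAt x
      ((hasDerivAt_id x).prodMk (hasDerivAt_const x t))).deriv

/-- Derivative of a directional derivative along a curve. -/
lemma hasDerivAt_fderiv_apply_comp {v : ℝ × ℝ → ℝ} {γ : ℝ → ℝ × ℝ} {d e : ℝ × ℝ} {τ : ℝ}
    (hv : ContDiffAt ℝ 2 v (γ τ)) (hγ : HasDerivAt γ d τ) :
    HasDerivAt (fun τ => fderiv ℝ v (γ τ) e) (fderiv ℝ (fderiv ℝ v) (γ τ) d e) τ := by
  have hD : DifferentiableAt ℝ (fderiv ℝ v) (γ τ) :=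
    (hv.fderiv_right (m := 1) (by norm_num)).differentiableAt (by norm_num)
  have h : HasDerivAt (fun τ => fderiv ℝ v (γ τ)) (fderiv ℝ (fderiv ℝ v) (γ τ) d) τ :=
    hD.hasFDerivAt.comp_hasDerivAt τ hγ
  exact (ContinuousLinearMap.apply ℝ ℝ e).hasFDerivAt.comp_hasDerivAt τ h

/-- The pure second partial derivatives of a `C²` function, in terms of its second total
derivative. -/
lemma deriv_deriv_partials_eq_fderiv_fderiv {u : ℝ → ℝ → ℝ} {U : Set (ℝ × ℝ)} (hU : IsOpen U)
    (hu : ContDiffOn ℝ 2 (fun p : ℝ × ℝ => u p.1 p.2) U) {x t : ℝ} (hxt : (x, t) ∈ U) :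
    deriv (deriv (u x)) t =
        fderiv ℝ (fderiv ℝ (fun p : ℝ × ℝ => u p.1 p.2)) (x, t) (0, 1) (0, 1) ∧
      deriv (deriv (fun y => u y t)) x =
        fderiv ℝ (fderiv ℝ (fun p : ℝ × ℝ => u p.1 p.2)) (x, t) (1, 0) (1, 0) := by
  have hdiff : ∀ p ∈ U, DifferentiableAt ℝ (fun p : ℝ × ℝ => u p.1 p.2) p := fun p hp =>
    (hu.contDiffAt (hU.mem_nhds hp)).differentiableAt (by norm_num)
  have hC2 := hu.contDiffAt (hU.mem_nhds hxt)
  have ht : HasDerivAt (fun s : ℝ => (x, s)) ((0 : ℝ), (1 : ℝ)) t :=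
    (hasDerivAt_const t x).prodMk (hasDerivAt_id t)
  have hx : HasDerivAt (fun y : ℝ => (y, t)) ((1 : ℝ), (0 : ℝ)) x :=
    (hasDerivAt_id x).prodMk (hasDerivAt_const x t)
  constructor
  · have he : deriv (u x) =ᶠ[nhds t]
        fun s => fderiv ℝ (fun p : ℝ × ℝ => u p.1 p.2) (x, s) (0, 1) := by
      filter_upwards [ht.continuousAt.preimage_mem_nhds (hU.mem_nhds hxt)] with s hs
      exact (deriv_partials_eq_fderiv (hdiff _ hs)).1
    rw [he.deriv_eq]
    exact (hasDerivAt_fderiv_apply_comp (γ := fun s => (x, s)) hC2 ht).deriv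
  · have he : deriv (fun y => u y t) =ᶠ[nhds x]
        fun y => fderiv ℝ (fun p : ℝ × ℝ => u p.1 p.2) (y, t) (1, 0) := by
      filter_upwards [hx.continuousAt.preimage_mem_nhds (hU.mem_nhds hxt)] with s hs
      exact (deriv_partials_eq_fderiv (hdiff _ hs)).2
    rw [he.deriv_eq]
    exact (hasDerivAt_fderiv_apply_comp (γ := fun y => (y, t)) hC2 hx).deriv

/-- A directional derivative `∂ₑ v` is constant along a segment of direction `d` on which
`∂_d ∂ₑ v = 0`. -/
lemma fderiv_apply_eq_of_segment {v : ℝ × ℝ → ℝ} {P d e : ℝ × ℝ} {m : ℝ} (hm : 0 ≤ m)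
    (hv : ∀ τ ∈ Set.Icc 0 m, ContDiffAt ℝ 2 v (P + τ • d))
    (h0 : ∀ τ ∈ Set.Icc 0 m, fderiv ℝ (fderiv ℝ v) (P + τ • d) d e = 0) :
    fderiv ℝ v (P + m • d) e = fderiv ℝ v P e := by
  have hder : ∀ τ ∈ Set.Icc 0 m,
      HasDerivAt (fun τ : ℝ => fderiv ℝ v (P + τ • d) e) 0 τ := by
    intro τ hτ
    have hl : HasDerivAt (fun τ : ℝ => P + τ • d) d τ := by
      simpa using ((hasDerivAt_id τ).smul_const d).const_add P
    exact (hasDerivAt_fderiv_apply_comp (γ := fun τ => P + τ • d) (hv τ hτ) hl).congr_deriv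
      (h0 τ hτ)
  have := constant_of_has_deriv_right_zero
    (fun τ hτ => (hder τ hτ).continuousAt.continuousWithinAt)
    (fun τ hτ => (hder τ ⟨hτ.1, hτ.2.le⟩).hasDerivWithinAt) m ⟨hm, le_rfl⟩
  simpa using this

/-- A function on `[0, ∞)` with speed less than one is `1`-Lipschitz. -/
lemma abs_sub_le_of_abs_deriv_lt_one {ℓ ℓ' : ℝ → ℝ}
    (hℓd : ∀ t ∈ Set.Ici (0 : ℝ), HasDerivWithinAt ℓ (ℓ' t) (Set.Ici 0) t)
    (hℓspeed : ∀ t ∈ Set.Ici (0 : ℝ), |ℓ' t| < 1) {s t : ℝ} (hs : 0 ≤ s) (hst : s ≤ t) :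
    |ℓ t - ℓ s| ≤ t - s := by
  have := (convex_Ici (0 : ℝ)).norm_image_sub_le_of_norm_hasDerivWithin_le hℓd
    (fun x hx => (hℓspeed x hx).le) (x := s) (y := t) hs (hs.trans hst)
  simpa [Real.norm_eq_abs, abs_of_nonneg (sub_nonneg.2 hst)] using this

/-- D'Alembert representation of the first derivatives of a solution of the wave equation in a
slowly moving domain, with a Dirichlet condition at `x = 0`. -/
lemma exists_dalembert_profile {L : ℝ} {ℓ ℓ' : ℝ → ℝ}
    (hℓd : ∀ t ∈ Set.Ici (0 : ℝ), HasDerivWithinAt ℓ (ℓ' t) (Set.Ici 0) t)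
    (hℓpos : ∀ t ∈ Set.Ici (0 : ℝ), 0 < ℓ t)
    (hℓspeed : ∀ t ∈ Set.Ici (0 : ℝ), |ℓ' t| < 1) (hL : ℓ 0 = L)
    {u : ℝ → ℝ → ℝ} {U : Set (ℝ × ℝ)} (hUopen : IsOpen U)
    (hUK : {p : ℝ × ℝ | 0 ≤ p.2 ∧ p.1 ∈ Set.Icc 0 (ℓ p.2)} ⊆ U)
    (huC2 : ContDiffOn ℝ 2 (fun p : ℝ × ℝ => u p.1 p.2) U)
    (hwave : ∀ x t : ℝ, 0 ≤ t → x ∈ Set.Icc 0 (ℓ t) →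
      deriv (deriv (u x)) t = deriv (deriv (fun y => u y t)) x)
    (hbc0 : ∀ t : ℝ, 0 ≤ t → u 0 t = 0) :
    ∃ g : ℝ → ℝ, Continuous g ∧ ∀ x t : ℝ, 0 ≤ t → x ∈ Set.Icc 0 (ℓ t) →
      deriv (u x) t = g (t + x) - g (t - x) ∧
        deriv (fun y => u y t) x = g (t + x) + g (t - x) := by
  set v : ℝ × ℝ → ℝ := fun p => u p.1 p.2
  have hC2 : ∀ p ∈ U, ContDiffAt ℝ 2 v p := fun p hp => huC2.contDiffAt (hUopen.mem_nhds hp)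
  have hmem : ∀ {x t : ℝ}, 0 ≤ t → 0 ≤ x → x ≤ ℓ t → (x, t) ∈ U :=
    fun ht hx hxl => hUK ⟨ht, hx, hxl⟩
  have hpart : ∀ {x t : ℝ}, (x, t) ∈ U → deriv (u x) t = fderiv ℝ v (x, t) (0, 1) ∧
      deriv (fun y => u y t) x = fderiv ℝ v (x, t) (1, 0) := fun h =>
    deriv_partials_eq_fderiv ((hC2 _ h).differentiableAt (by norm_num))
  have hchar : ∀ {x t : ℝ}, 0 ≤ t → 0 ≤ x → x ≤ ℓ t →
      fderiv ℝ (fderiv ℝ v) (x, t) (-1, 1) (1, 1) = 0 ∧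
        fderiv ℝ (fderiv ℝ v) (x, t) (-1, -1) (1, -1) = 0 := by
    intro x t ht hx hxl
    have hU := hmem ht hx hxl
    have h2 := deriv_deriv_partials_eq_fderiv_fderiv hUopen huC2 hU
    have hw := hwave x t ht ⟨hx, hxl⟩
    rw [h2.1, h2.2] at hw
    have hsymm : fderiv ℝ (fderiv ℝ v) (x, t) (1, 0) (0, 1) =
        fderiv ℝ (fderiv ℝ v) (x, t) (0, 1) (1, 0) :=
      ((hC2 _ hU).isSymmSndFDerivAt (by simp)).eq _ _
    have e1 : ((-1 : ℝ), (1 : ℝ)) = -(1, 0) + (0, 1) := by simp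
    have e2 : ((1 : ℝ), (1 : ℝ)) = (1, 0) + (0, 1) := by simp
    have e3 : ((-1 : ℝ), (-1 : ℝ)) = -(1, 0) - (0, 1) := by simp
    have e4 : ((1 : ℝ), (-1 : ℝ)) = (1, 0) - (0, 1) := by simp
    rw [e1, e2, e3, e4]
    simp only [map_add, map_sub, map_neg, add_apply, sub_apply, neg_apply]
    constructor <;> linarith
  have hbot : ∀ s : ℝ, 0 ≤ s → fderiv ℝ v (0, s) (0, 1) = 0 := by
    intro s hs
    have hU := hmem hs le_rfl (hℓpos s hs).le
    have hd : HasDerivAt (u 0) (fderiv ℝ v (0, s) (0, 1)) s :=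
      ((hC2 _ hU).differentiableAt (by norm_num)).hasFDerivAt.comp_hasDerivAt s
        ((hasDerivAt_const s (0 : ℝ)).prodMk (hasDerivAt_id s))
    have h0 : HasDerivWithinAt (u 0) 0 (Set.Ici 0) s :=
      (hasDerivWithinAt_const s (Set.Ici 0) (0 : ℝ)).congr (fun y hy => hbc0 y hy) (hbc0 s hs)
    exact (uniqueDiffOn_Ici (0 : ℝ) s hs).eq_deriv _ hd.hasDerivWithinAt h0
  let c : ℝ → ℝ × ℝ := fun s => (max (-max s (-L)) 0, max (max s (-L)) 0)
  have hLpos : 0 < L := hL ▸ hℓpos 0 Set.self_mem_Ici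
  have hcU : ∀ s, c s ∈ U := by
    intro s
    refine hmem (le_max_right _ _) (le_max_right _ _) ?_
    rcases le_total 0 (max s (-L)) with h | h
    · rw [max_eq_right (by linarith : -max s (-L) ≤ 0)]
      exact (hℓpos _ (Set.mem_Ici.2 (le_max_right _ _))).le
    · rw [max_eq_right h, hL]
      exact max_le (by linarith [le_max_right s (-L)]) hLpos.le
  have hDcont : ContinuousOn (fderiv ℝ v) U :=
    huC2.continuousOn_fderiv_of_isOpen hUopen (by norm_num)
  have hc : Continuous c := by fun_prop
  refine ⟨fun s => fderiv ℝ v (c s) (1, -1) / 2, ?_, ?_⟩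
  · exact ((hDcont.comp_continuous hc hcU).clm_apply continuous_const).div_const 2
  intro x t ht ⟨hx, hxl⟩
  have hU := hmem ht hx hxl
  have hright : fderiv ℝ v (x, t) (1, 1) = fderiv ℝ v (c (t + x)) (1, -1) := by
    have hpt : ∀ τ : ℝ, (x, t) + τ • ((-1 : ℝ), (1 : ℝ)) = (x - τ, t + τ) := by
      intro τ; ext <;> simp; ring
    have hin : ∀ τ ∈ Set.Icc 0 x, x - τ ≤ ℓ (t + τ) := fun τ hτ => by
      have := abs_le.1 (abs_sub_le_of_abs_deriv_lt_one hℓd hℓspeed ht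
        (by linarith [hτ.1] : t ≤ t + τ))
      linarith [this.1]
    have key := fderiv_apply_eq_of_segment (v := v) (P := (x, t)) (d := (-1, 1)) (e := (1, 1)) hx
      (fun τ hτ => by
        rw [hpt]
        exact hC2 _ (hmem (by linarith [hτ.1]) (by linarith [hτ.2]) (hin τ hτ)))
      (fun τ hτ => by
        rw [hpt]
        exact (hchar (by linarith [hτ.1]) (by linarith [hτ.2]) (hin τ hτ)).1)
    rw [hpt, sub_self] at key
    have hcs : c (t + x) = (0, t + x) := by
      simp only [c]
      rw [max_eq_left (by linarith : -L ≤ t + x), max_eq_right (by linarith : -(t + x) ≤ 0),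
        max_eq_left (by linarith : 0 ≤ t + x)]
    have hb := hbot (t + x) (by linarith)
    have e2 : ((1 : ℝ), (1 : ℝ)) = (1, 0) + (0, 1) := by simp
    have e4 : ((1 : ℝ), (-1 : ℝ)) = (1, 0) - (0, 1) := by simp
    rw [← key, hcs, e2, e4, map_add, map_sub, hb, add_zero, sub_zero]
  have hleft : fderiv ℝ v (x, t) (1, -1) = fderiv ℝ v (c (t - x)) (1, -1) := by
    have hpt : ∀ τ : ℝ, (x, t) + τ • ((-1 : ℝ), (-1 : ℝ)) = (x - τ, t - τ) := by
      intro τ; ext <;> simp <;> ring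
    have hin : ∀ τ ∈ Set.Icc 0 (min x t), 0 ≤ t - τ ∧ 0 ≤ x - τ ∧ x - τ ≤ ℓ (t - τ) :=
      fun τ hτ => by
        have h1 := hτ.2.trans (min_le_left _ _)
        have h2 := hτ.2.trans (min_le_right _ _)
        have := abs_le.1 (abs_sub_le_of_abs_deriv_lt_one hℓd hℓspeed
          (by linarith : 0 ≤ t - τ) (by linarith [hτ.1] : t - τ ≤ t))
        exact ⟨by linarith, by linarith, by linarith [this.2]⟩
    have key := fderiv_apply_eq_of_segment (v := v) (P := (x, t)) (d := (-1, -1)) (e := (1, -1))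
      (le_min hx ht)
      (fun τ hτ => by
        obtain ⟨h1, h2, h3⟩ := hin τ hτ
        rw [hpt]
        exact hC2 _ (hmem h1 h2 h3))
      (fun τ hτ => by
        obtain ⟨h1, h2, h3⟩ := hin τ hτ
        rw [hpt]
        exact (hchar h1 h2 h3).2)
    have hLx : -L ≤ t - x := by
      have := abs_le.1 (abs_sub_le_of_abs_deriv_lt_one hℓd hℓspeed le_rfl ht)
      linarith [this.2]
    have hcs : c (t - x) = (x - min x t, t - min x t) := by
      simp only [c]
      rw [max_eq_left hLx]
      rcases le_total x t with h | h
      · rw [min_eq_left h, max_eq_right (by linarith), max_eq_left (by linarith), sub_self]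
      · rw [min_eq_right h, max_eq_left (by linarith), max_eq_right (by linarith), sub_self,
          neg_sub]
    rw [← key, hpt, hcs]
  have e2 : ((1 : ℝ), (1 : ℝ)) = (1, 0) + (0, 1) := by simp
  have e4 : ((1 : ℝ), (-1 : ℝ)) = (1, 0) - (0, 1) := by simp
  dsimp only
  rw [← hright, ← hleft, (hpart hU).1, (hpart hU).2, e2, e4, map_add, map_sub]
  constructor <;> ring

/-- Derivative of the integral of a continuous function over `[t - ℓ t, t + ℓ t]`. -/
lemma hasDerivAt_integral_sub_add {F ℓ : ℝ → ℝ} {t m : ℝ} (hF : Continuous F)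
    (hℓ : HasDerivAt ℓ m t) :
    HasDerivAt (fun t => ∫ s in (t - ℓ t)..(t + ℓ t), F s)
      ((1 + m) * F (t + ℓ t) - (1 - m) * F (t - ℓ t)) t := by
  have hp : ∀ x, HasDerivAt (fun x => ∫ s in (0 : ℝ)..x, F s) (F x) x := fun x =>
    hF.integral_hasStrictDerivAt 0 x |>.hasDerivAt
  have h1 := (hp (t + ℓ t)).comp t ((hasDerivAt_id t).add hℓ)
  have h2 := (hp (t - ℓ t)).comp t ((hasDerivAt_id t).sub hℓ)
  refine ((h1.sub h2).congr_of_eventuallyEq (Filter.Eventually.of_forall fun y => ?_)).congr_deriv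
    (by ring)
  exact (intervalIntegral.integral_interval_sub_left (hF.intervalIntegrable _ _)
    (hF.intervalIntegrable _ _)).symm

/-- The derivative of a `C¹` function on `[a, ∞)` is continuous there. -/
lemma continuousOn_of_hasDerivWithinAt_Ici {f f' : ℝ → ℝ} {a : ℝ}
    (hf : ContDiffOn ℝ 1 f (Set.Ici a))
    (hd : ∀ s ∈ Set.Ici a, HasDerivWithinAt f (f' s) (Set.Ici a) s) :
    ContinuousOn f' (Set.Ici a) :=
  (hf.continuousOn_derivWithin (uniqueDiffOn_Ici a) le_rfl).congr fun s hs =>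
    ((hd s hs).derivWithin (uniqueDiffOn_Ici a s hs)).symm

/-- Differentiated form of Moore's functional equation. -/
lemma deriv_moore {L : ℝ} {ℓ ℓ' φ φ' : ℝ → ℝ}
    (hℓd : ∀ t ∈ Set.Ici (0 : ℝ), HasDerivWithinAt ℓ (ℓ' t) (Set.Ici 0) t)
    (hφd : ∀ s ∈ Set.Ici (-L), HasDerivWithinAt φ (φ' s) (Set.Ici (-L)) s)
    (hlo : ∀ t ∈ Set.Ici (0 : ℝ), -L ≤ t - ℓ t) (hhi : ∀ t ∈ Set.Ici (0 : ℝ), -L ≤ t + ℓ t)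
    (hMoore : ∀ t ∈ Set.Ici (0 : ℝ), φ (t + ℓ t) - φ (t - ℓ t) = 2) {t : ℝ} (ht : 0 ≤ t) :
    (1 + ℓ' t) * φ' (t + ℓ t) = (1 - ℓ' t) * φ' (t - ℓ t) := by
  have hid := hasDerivWithinAt_id t (Set.Ici (0 : ℝ))
  have h1 := (hφd _ (hhi t ht)).comp t (hid.add (hℓd t ht)) hhi
  have h2 := (hφd _ (hlo t ht)).comp t (hid.sub (hℓd t ht)) hlo
  have h0 := (hasDerivWithinAt_const t (Set.Ici 0) (2 : ℝ)).congr hMoore (hMoore t ht)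
  have := (uniqueDiffOn_Ici (0 : ℝ) t ht).eq_deriv _ (h1.sub h2) h0
  linarith

/-- If `f` is monotone on the union of the intervals `[t - ℓ t, t + ℓ t]`, `t ∈ [a, b]`, and does
not increase across any of them, then it is constant. -/
lemma antitoneOn_of_monotoneOn_of_le {f ℓ : ℝ → ℝ} {a b : ℝ} (hab : a ≤ b)
    (hℓpos : 0 < ℓ a) (hℓmono : MonotoneOn ℓ (Set.Icc a b))
    (hlo : MonotoneOn (fun t => t - ℓ t) (Set.Icc a b))
    (hf : MonotoneOn f (Set.Icc (a - ℓ a) (b + ℓ b)))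
    (hle : ∀ t ∈ Set.Icc a b, f (t + ℓ t) ≤ f (t - ℓ t)) :
    AntitoneOn f (Set.Icc (a - ℓ a) (b + ℓ b)) := by
  have ha : a ∈ Set.Icc a b := ⟨le_rfl, hab⟩
  have hb : b ∈ Set.Icc a b := ⟨hab, le_rfl⟩
  have hsub : ∀ t ∈ Set.Icc a b, 0 < ℓ t ∧ a - ℓ a ≤ t - ℓ t ∧ t + ℓ t ≤ b + ℓ b := fun t ht =>
    ⟨hℓpos.trans_le (hℓmono ha ht ht.1), hlo ha ht ht.1,
      add_le_add ht.2 (hℓmono ht hb ht.2)⟩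
  have hconst : ∀ t ∈ Set.Icc a b, ∀ s ∈ Set.Icc (t - ℓ t) (t + ℓ t), f s = f t := by
    intro t ht
    obtain ⟨h1, h2, h3⟩ := hsub t ht
    have hval : ∀ s ∈ Set.Icc (t - ℓ t) (t + ℓ t), f s = f (t - ℓ t) := fun s hs =>
      le_antisymm ((hf ⟨by linarith [hs.1], by linarith [hs.2]⟩
          ⟨by linarith, by linarith⟩ hs.2).trans (hle t ht))
        (hf ⟨by linarith, by linarith⟩ ⟨by linarith [hs.1], by linarith [hs.2]⟩ hs.1)
    intro s hs
    rw [hval s hs, hval t ⟨by linarith, by linarith⟩]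
  have hder : ∀ t ∈ Set.Icc a b, HasDerivWithinAt f 0 (Set.Icc a b) t := by
    intro t ht
    have h1 := (hsub t ht).1
    refine (hasDerivWithinAt_const t (Set.Icc a b) (f t)).congr_of_eventuallyEq ?_ rfl
    exact mem_nhdsWithin_of_mem_nhds (Filter.mem_of_superset
      (Icc_mem_nhds (by linarith : t - ℓ t < t) (by linarith : t < t + ℓ t)) (hconst t ht))
  have hall : ∀ t ∈ Set.Icc a b, f t = f a :=
    constant_of_derivWithin_zero (fun t ht => (hder t ht).differentiableWithinAt) fun t ht => by
      have hlt : a < b := ht.1.trans_lt ht.2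
      exact (hder t ⟨ht.1, ht.2.le⟩).derivWithin (uniqueDiffOn_Icc hlt t ⟨ht.1, ht.2.le⟩)
  have hfa : ∀ s ∈ Set.Icc (a - ℓ a) (b + ℓ b), f s = f a := by
    intro s hs
    rcases le_total s a with h | h
    · exact hconst a ha s ⟨hs.1, by linarith⟩
    rcases le_total s b with h' | h'
    · exact hall s ⟨h, h'⟩
    · rw [hconst b hb s ⟨by linarith [(hsub b hb).1], hs.2⟩, hall b hb]
  intro x hx y hy _
  rw [hfa x hx, hfa y hy]

theorem undamped_expanding_energy_estimate
    (L : ℝ) (ℓ ℓ' : ℝ → ℝ)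
    (hℓC1 : ContDiffOn ℝ 1 ℓ (Set.Ici 0))
    (hℓd : ∀ t ∈ Set.Ici (0:ℝ), HasDerivWithinAt ℓ (ℓ' t) (Set.Ici 0) t)
    (hℓpos : ∀ t ∈ Set.Ici (0:ℝ), 0 < ℓ t)
    (hℓspeed : ∀ t ∈ Set.Ici (0:ℝ), |ℓ' t| < 1)
    (hL : ℓ 0 = L)
    (u : ℝ → ℝ → ℝ) (U : Set (ℝ × ℝ)) (hUopen : IsOpen U)
    (hUK : {p : ℝ × ℝ | 0 ≤ p.2 ∧ p.1 ∈ Set.Icc 0 (ℓ p.2)} ⊆ U)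
    (huC2 : ContDiffOn ℝ 2 (fun p : ℝ × ℝ => u p.1 p.2) U)
    (hwave : ∀ x t : ℝ, 0 ≤ t → x ∈ Set.Icc 0 (ℓ t) →
      deriv (deriv (u x)) t = deriv (deriv (fun y => u y t)) x)
    (hbc0 : ∀ t : ℝ, 0 ≤ t → u 0 t = 0)
    (hbcℓ : ∀ t : ℝ, 0 < t →
      deriv (fun y => u y t) (ℓ t) + ℓ' t * deriv (u (ℓ t)) t = 0)
    (φ φ' : ℝ → ℝ)
    (hφC1 : ContDiffOn ℝ 1 φ (Set.Ici (-L)))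
    (hφd : ∀ s ∈ Set.Ici (-L), HasDerivWithinAt φ (φ' s) (Set.Ici (-L)) s)
    (hφpos : ∀ s ∈ Set.Ici (-L), 0 < φ' s)
    (hMoore : ∀ t ∈ Set.Ici (0:ℝ), φ (t + ℓ t) - φ (t - ℓ t) = 2)
    (E : ℝ → ℝ)
    (hE : ∀ t : ℝ, E t = (1/2) * ∫ x in (0:ℝ)..(ℓ t),
      ((deriv (u x) t)^2 + (deriv (fun y => u y t) x)^2))
    (t₀ t₁ : ℝ) (ht₀ : 0 ≤ t₀) (ht₀₁ : t₀ ≤ t₁)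
    (hmono : MonotoneOn φ' (Set.Icc (t₀ - ℓ t₀) (t₁ + ℓ t₁)) ∨
      AntitoneOn φ' (Set.Icc (t₀ - ℓ t₀) (t₁ + ℓ t₁)))
    (hexp : ∀ t ∈ Set.Icc t₀ t₁, 0 ≤ ℓ' t ∧ ℓ' t < 1)
    : AntitoneOn φ' (Set.Icc (t₀ - ℓ t₀) (t₁ + ℓ t₁)) ∧
      AntitoneOn E (Set.Icc t₀ t₁) ∧
      ∀ t ∈ Set.Icc t₀ t₁,
        φ' (t + ℓ t) / φ' (t₀ - ℓ t₀) * E t₀ ≤ E t ∧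
        E t ≤ φ' (t - ℓ t) / φ' (t₀ + ℓ t₀) * E t₀ := by
  have hlip : ∀ {s t : ℝ}, 0 ≤ s → s ≤ t → |ℓ t - ℓ s| ≤ t - s := fun hs hst =>
    abs_sub_le_of_abs_deriv_lt_one hℓd hℓspeed hs hst
  have hlo : ∀ t ∈ Set.Ici (0 : ℝ), -L ≤ t - ℓ t := fun t ht => by
    linarith [(abs_le.1 (hlip le_rfl ht)).2]
  have hhi : ∀ t ∈ Set.Ici (0 : ℝ), -L ≤ t + ℓ t := fun t ht => by
    linarith [hlo t ht, hℓpos t ht]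
  have hM : ∀ t : ℝ, 0 ≤ t → (1 + ℓ' t) * φ' (t + ℓ t) = (1 - ℓ' t) * φ' (t - ℓ t) :=
    fun t ht => deriv_moore hℓd hφd hlo hhi hMoore ht
  have hpos : ∀ t ∈ Set.Icc t₀ t₁, 0 ≤ t := fun t ht => ht₀.trans ht.1
  have hℓat : ∀ t : ℝ, 0 < t → HasDerivAt ℓ (ℓ' t) t := fun t ht =>
    (hℓd t ht.le).hasDerivAt (Ici_mem_nhds ht)
  have hℓcont : ContinuousOn ℓ (Set.Icc t₀ t₁) :=
    hℓC1.continuousOn.mono fun t ht => hpos t ht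
  have hinterior : ∀ t ∈ interior (Set.Icc t₀ t₁), t ∈ Set.Icc t₀ t₁ ∧ 0 < t := fun t ht => by
    rw [interior_Icc] at ht
    exact ⟨⟨ht.1.le, ht.2.le⟩, ht₀.trans_lt ht.1⟩
  have hℓmono : MonotoneOn ℓ (Set.Icc t₀ t₁) :=
    monotoneOn_of_hasDerivWithinAt_nonneg (convex_Icc _ _) hℓcont
      (fun t ht => (hℓat t (hinterior t ht).2).hasDerivWithinAt) fun t ht => (hexp t (hinterior t ht).1).1
  have hlomono : MonotoneOn (fun t => t - ℓ t) (Set.Icc t₀ t₁) := fun s hs t ht hst => by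
    linarith [(abs_le.1 (hlip (hpos s hs) hst)).2]
  have hm₀ : t₀ ∈ Set.Icc t₀ t₁ := ⟨le_rfl, ht₀₁⟩
  have hm₁ : t₁ ∈ Set.Icc t₀ t₁ := ⟨ht₀₁, le_rfl⟩
  have hanti : AntitoneOn φ' (Set.Icc (t₀ - ℓ t₀) (t₁ + ℓ t₁)) := by
    refine hmono.elim (fun hmon => ?_) id
    refine antitoneOn_of_monotoneOn_of_le ht₀₁ (hℓpos t₀ ht₀) hℓmono hlomono hmon fun t ht => ?_
    have h1 := hM t (hpos t ht)
    have h2 := hφpos _ (hlo t (hpos t ht))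
    have h3 := hφpos _ (hhi t (hpos t ht))
    nlinarith [mul_nonneg (hexp t ht).1 h2.le, mul_nonneg (hexp t ht).1 h3.le]
  obtain ⟨g, hg, hgu⟩ := exists_dalembert_profile hℓd hℓpos hℓspeed hL hUopen hUK huC2 hwave hbc0
  have hsq : Continuous fun s => g s ^ 2 := hg.pow 2
  have hEg : ∀ t : ℝ, 0 ≤ t → E t = ∫ s in (t - ℓ t)..(t + ℓ t), g s ^ 2 := by
    intro t ht
    have h1 : (∫ x in (0 : ℝ)..(ℓ t), ((deriv (u x) t)^2 + (deriv (fun y => u y t) x)^2)) =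
        ∫ x in (0 : ℝ)..(ℓ t), 2 * (g (t + x) ^ 2 + g (t - x) ^ 2) := by
      refine intervalIntegral.integral_congr fun x hx => ?_
      rw [Set.uIcc_of_le (hℓpos t ht).le] at hx
      rw [(hgu x t ht hx).1, (hgu x t ht hx).2]
      ring
    rw [hE, h1, intervalIntegral.integral_const_mul, intervalIntegral.integral_add
      (Continuous.intervalIntegrable (by fun_prop) _ _)
      (Continuous.intervalIntegrable (by fun_prop) _ _),
      intervalIntegral.integral_comp_add_left (fun s => g s ^ 2),
      intervalIntegral.integral_comp_sub_left (fun s => g s ^ 2), add_zero, sub_zero,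
      ← intervalIntegral.integral_add_adjacent_intervals (hsq.intervalIntegrable (t - ℓ t) t)
        (hsq.intervalIntegrable t (t + ℓ t))]
    ring
  have hbc : ∀ t : ℝ, 0 < t → (1 + ℓ' t) * g (t + ℓ t) = -((1 - ℓ' t) * g (t - ℓ t)) := by
    intro t ht
    have h := hbcℓ t ht
    obtain ⟨h1, h2⟩ := hgu (ℓ t) t ht.le ⟨(hℓpos t ht.le).le, le_rfl⟩
    rw [h1, h2] at h
    linarith
  have hIcont : ∀ F : ℝ → ℝ, Continuous F →
      ContinuousOn (fun t => ∫ s in (t - ℓ t)..(t + ℓ t), F s) (Set.Icc t₀ t₁) := by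
    intro F hF
    have hp : Continuous fun x => ∫ s in (0 : ℝ)..x, F s :=
      intervalIntegral.continuous_primitive (fun a b => hF.intervalIntegrable a b) 0
    refine ((hp.comp_continuousOn (continuousOn_id.add hℓcont)).sub
      (hp.comp_continuousOn (continuousOn_id.sub hℓcont))).congr fun t _ => ?_
    exact (intervalIntegral.integral_interval_sub_left (hF.intervalIntegrable _ _)
      (hF.intervalIntegrable _ _)).symm
  have hEanti : AntitoneOn E (Set.Icc t₀ t₁) := by
    refine AntitoneOn.congr (antitoneOn_of_hasDerivWithinAt_nonpos (convex_Icc _ _)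
      (hIcont _ hsq) (fun t ht => (hasDerivAt_integral_sub_add hsq
        (hℓat t (hinterior t ht).2)).hasDerivWithinAt) fun t ht => ?_)
      fun t ht => (hEg t (hpos t ht)).symm
    obtain ⟨htI, ht0⟩ := hinterior t ht
    obtain ⟨he0, he1⟩ := hexp t htI
    have hb := hbc t ht0
    have hkey : (1 + ℓ' t) * ((1 + ℓ' t) * g (t + ℓ t) ^ 2 - (1 - ℓ' t) * g (t - ℓ t) ^ 2) =
        -(2 * ℓ' t * (1 - ℓ' t) * g (t - ℓ t) ^ 2) := by
      linear_combination ((1 + ℓ' t) * g (t + ℓ t) - (1 - ℓ' t) * g (t - ℓ t)) * hb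
    have hnn : 0 ≤ 2 * ℓ' t * (1 - ℓ' t) * g (t - ℓ t) ^ 2 :=
      mul_nonneg (mul_nonneg (by linarith) (by linarith)) (sq_nonneg _)
    exact nonpos_of_mul_nonpos_right (by linarith [hkey]) (by linarith : 0 < 1 + ℓ' t)
  let ψ : ℝ → ℝ := fun s => φ' (max s (-L))
  have hψ : Continuous ψ := (continuousOn_of_hasDerivWithinAt_Ici hφC1 hφd).comp_continuous
    (continuous_id.max continuous_const) fun s => Set.mem_Ici.2 (le_max_right _ _)
  have hψpos : ∀ s, 0 < ψ s := fun s => hφpos _ (Set.mem_Ici.2 (le_max_right _ _))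
  have hψeq : ∀ s, -L ≤ s → ψ s = φ' s := fun s hs => congrArg φ' (max_eq_left hs)
  let S : ℝ → ℝ := fun t => ∫ s in (t - ℓ t)..(t + ℓ t), g s ^ 2 / ψ s
  have hFc : Continuous fun s => g s ^ 2 / ψ s := hsq.div hψ fun s => (hψpos s).ne'
  have hSderiv : ∀ t : ℝ, 0 < t → HasDerivAt S 0 t := by
    intro t ht
    refine (hasDerivAt_integral_sub_add hFc (hℓat t ht)).congr_deriv ?_
    rw [hψeq _ (hhi t ht.le), hψeq _ (hlo t ht.le)]
    have hp := hφpos _ (hhi t ht.le)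
    have hq := hφpos _ (hlo t ht.le)
    have hm := hM t ht.le
    have hb := hbc t ht
    have hs := abs_lt.1 (hℓspeed t ht.le)
    have hne : (1 + ℓ' t) ≠ 0 := by linarith [hs.1]
    rw [sub_eq_zero, mul_div_assoc', mul_div_assoc', div_eq_div_iff hp.ne' hq.ne']
    apply mul_left_cancel₀ hne
    linear_combination φ' (t - ℓ t) * ((1 + ℓ' t) * g (t + ℓ t) - (1 - ℓ' t) * g (t - ℓ t)) * hb
      - (1 - ℓ' t) * g (t - ℓ t) ^ 2 * hm
  have hSconst : ∀ t ∈ Set.Icc t₀ t₁, S t = S t₀ := fun t ht =>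
    le_antisymm
      (antitoneOn_of_hasDerivWithinAt_nonpos (convex_Icc _ _) (hIcont _ hFc)
        (fun t ht => (hSderiv t (hinterior t ht).2).hasDerivWithinAt) (fun _ _ => le_rfl) hm₀ ht ht.1)
      (monotoneOn_of_hasDerivWithinAt_nonneg (convex_Icc _ _) (hIcont _ hFc)
        (fun t ht => (hSderiv t (hinterior t ht).2).hasDerivWithinAt) (fun _ _ => le_rfl) hm₀ ht ht.1)
  have hbounds : ∀ t ∈ Set.Icc t₀ t₁,
      φ' (t + ℓ t) * S t ≤ E t ∧ E t ≤ φ' (t - ℓ t) * S t := by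
    intro t ht
    have h0 := hpos t ht
    have hl := hℓpos t h0
    have hle : t - ℓ t ≤ t + ℓ t := by linarith
    have hin : ∀ s ∈ Set.Icc (t - ℓ t) (t + ℓ t), s ∈ Set.Icc (t₀ - ℓ t₀) (t₁ + ℓ t₁) :=
      fun s hs => ⟨(hlomono hm₀ ht ht.1).trans hs.1,
        hs.2.trans (add_le_add ht.2 (hℓmono ht hm₁ ht.2))⟩
    have hcancel : ∀ s, ψ s * (g s ^ 2 / ψ s) = g s ^ 2 := fun s =>
      mul_div_cancel₀ _ (hψpos s).ne'
    have hnn : ∀ s, 0 ≤ g s ^ 2 / ψ s := fun s => div_nonneg (sq_nonneg _) (hψpos s).le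
    rw [hEg t h0]
    simp only [S]
    rw [← intervalIntegral.integral_const_mul, ← intervalIntegral.integral_const_mul]
    constructor
    · refine intervalIntegral.integral_mono_on hle
        ((continuous_const.mul hFc).intervalIntegrable _ _)
        (hsq.intervalIntegrable _ _) fun s hs => ?_
      conv_rhs => rw [← hcancel s]
      refine mul_le_mul_of_nonneg_right ?_ (hnn s)
      rw [hψeq s ((hlo t h0).trans hs.1)]
      exact hanti (hin s hs) (hin _ ⟨hle, le_rfl⟩) hs.2
    · refine intervalIntegral.integral_mono_on hle (hsq.intervalIntegrable _ _)
        ((continuous_const.mul hFc).intervalIntegrable _ _) fun s hs => ?_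
      conv_lhs => rw [← hcancel s]
      refine mul_le_mul_of_nonneg_right ?_ (hnn s)
      rw [hψeq s ((hlo t h0).trans hs.1)]
      exact hanti (hin _ ⟨le_rfl, hle⟩) (hin s hs) hs.1
  refine ⟨hanti, hEanti, fun t ht => ?_⟩
  obtain ⟨hl₀, hu₀⟩ := hbounds t₀ hm₀
  obtain ⟨hl, hu⟩ := hbounds t ht
  rw [hSconst t ht] at hl hu
  have hp := hφpos _ (hhi t (hpos t ht))
  have hq := hφpos _ (hlo t (hpos t ht))
  have hp₀ := hφpos _ (hhi t₀ ht₀)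
  have hq₀ := hφpos _ (hlo t₀ ht₀)
  constructor
  · refine le_trans ?_ hl
    rw [div_mul_eq_mul_div, mul_div_assoc]
    exact mul_le_mul_of_nonneg_left ((div_le_iff₀' hq₀).2 hu₀) hp.le
  · refine hu.trans ?_
    rw [div_mul_eq_mul_div, mul_div_assoc]
    exact mul_le_mul_of_nonneg_left ((le_div_iff₀' hp₀).2 hl₀) hq.le
end
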